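/- arXiv:math/0504606 — 2 statements merged into one kernel-verified Lean document; each statement's English description precedes it below -/
import Mathlib

section
/- Let k ≥ 1 and let g_1, …, g_k be complex-analytic functions on a neighborhood of 0 in ℂ. Then, as the tuple (w_1, …, w_k) of pairwise distinct complex numbers tends to (0, …, 0), the ratio det(g_n(w_m))_{1≤m,n≤k} / ∏_{1≤m<n≤k} (w_n − w_m) converges to det(g_n^{(m−1)}(0))_{1≤m,n≤k} / ∏_{j=0}^{k−1} j!. -/
open Filter

open Metric in
/-- A circle integral whose integrand depends continuously on a parameter is continuous in that
parameter. -/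
theorem tendsto_circleIntegral_of_continuousOn_prod {X : Type*} [TopologicalSpace X]
    [FirstCountableTopology X] {F : X → ℂ → ℂ} {c : ℂ} {R : ℝ} (hR : 0 ≤ R) {U : Set X} {a : X}
    (hU : U ∈ nhds a) (hF : ContinuousOn F.uncurry (U ×ˢ sphere c R)) :
    Tendsto (fun x => ∮ z in C(c, R), F x z) (nhds a) (nhds (∮ z in C(c, R), F a z)) := by
  refine TendstoUniformlyOn.tendsto_circleIntegral_of_continuousOn hR ?_ ?_
  · filter_upwards [hU] with x hx
    exact hF.comp (f := fun z => (x, z)) (by fun_prop) fun z hz => ⟨hx, hz⟩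
  · intro u hu
    obtain ⟨v, hv, hvu⟩ := (isCompact_sphere c R).mem_uniformity_of_prod hF (mem_of_mem_nhds hU)
      (symm_le_uniformity hu)
    rw [nhdsWithin_eq_nhds.2 hU] at hv
    filter_upwards [hv] with x hx z hz
    exact hvu x hx z hz

/-- The Newton expansion of the Cauchy kernel. -/
theorem sum_prod_sub_div_prod_sub (v : ℕ → ℂ) {z x : ℂ} (hx : z ≠ x) {n : ℕ}
    (hz : ∀ i < n, z ≠ v i) :
    ∑ j ∈ Finset.range n,
        (∏ i ∈ Finset.range j, (x - v i)) * (∏ i ∈ Finset.range (j + 1), (z - v i))⁻¹ =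
      (1 - (∏ i ∈ Finset.range n, (x - v i)) * (∏ i ∈ Finset.range n, (z - v i))⁻¹) *
        (z - x)⁻¹ := by
  have hx' : z - x ≠ 0 := sub_ne_zero.2 hx
  induction n with
  | zero => simp
  | succ n ih =>
    rw [Finset.sum_range_succ, ih fun i hi => hz i (by omega)]
    have hn : z - v n ≠ 0 := sub_ne_zero.2 (hz n (by omega))
    have hp : ∏ i ∈ Finset.range n, (z - v i) ≠ 0 :=
      Finset.prod_ne_zero_iff.2 fun i hi =>
        sub_ne_zero.2 (hz i (by have := Finset.mem_range.1 hi; omega))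
    simp only [Finset.prod_range_succ]
    field_simp
    ring

/-- The divided difference `f[v 0, …, v j]` of `f`, as a Cauchy integral over the circle of
radius `R`. -/
noncomputable def cauchyDividedDifference (R : ℝ) (f : ℂ → ℂ) (v : ℕ → ℂ) (j : ℕ) : ℂ :=
  (2 * Real.pi * Complex.I)⁻¹ *
    ∮ z in C(0, R), (∏ i ∈ Finset.range (j + 1), (z - v i))⁻¹ * f z

section

open Metric

variable {R : ℝ} {f : ℂ → ℂ}

/-- The Newton interpolation formula at one of the nodes. -/
theorem eq_sum_cauchyDividedDifference (hf : DifferentiableOn ℂ f (closedBall 0 R))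
    {v : ℕ → ℂ} (hv : ∀ i, v i ∈ ball 0 R) {m n : ℕ} (hmn : m < n) :
    f (v m) = ∑ j ∈ Finset.range n,
      (∏ i ∈ Finset.range j, (v m - v i)) * cauchyDividedDifference R f v j := by
  have hR : 0 < R := pos_of_mem_ball (hv 0)
  have hne {z : ℂ} (hz : z ∈ sphere 0 R) (i : ℕ) : z ≠ v i := by
    rintro rfl
    exact (mem_ball.1 (hv i)).ne (mem_sphere.1 hz)
  have hcauchy := hf.circleIntegral_sub_inv_smul (hv m)
  have hkernel : (∮ z in C(0, R), (z - v m)⁻¹ • f z) =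
      ∮ z in C(0, R), ∑ j ∈ Finset.range n, (∏ i ∈ Finset.range j, (v m - v i)) *
        ((∏ i ∈ Finset.range (j + 1), (z - v i))⁻¹ * f z) := by
    refine circleIntegral.integral_congr hR.le fun z hz => ?_
    have := sum_prod_sub_div_prod_sub v (hne hz m) (n := n) fun i _ => hne hz i
    rw [Finset.prod_eq_zero (Finset.mem_range.2 hmn) (sub_self (v m)), zero_mul, sub_zero,
      one_mul] at this
    simp only [smul_eq_mul, ← this, Finset.sum_mul, mul_assoc]
  have hint (j : ℕ) : CircleIntegrable (fun z => (∏ i ∈ Finset.range j, (v m - v i)) *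
      ((∏ i ∈ Finset.range (j + 1), (z - v i))⁻¹ * f z)) 0 R := by
    refine ContinuousOn.circleIntegrable hR.le (continuousOn_const.mul (.mul (.inv₀ ?_ ?_) ?_))
    · fun_prop
    · exact fun z hz => Finset.prod_ne_zero_iff.2 fun i _ => sub_ne_zero.2 (hne hz i)
    · exact hf.continuousOn.mono sphere_subset_closedBall
  rw [hkernel, circleIntegral.integral_fun_sum fun j _ => hint j] at hcauchy
  simp only [circleIntegral.integral_const_mul, smul_eq_mul] at hcauchy
  simp only [cauchyDividedDifference, mul_left_comm _ (2 * (Real.pi : ℂ) * Complex.I)⁻¹,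
    ← Finset.mul_sum]
  rw [hcauchy, inv_mul_cancel_left₀ Complex.two_pi_I_ne_zero]

theorem cauchyDividedDifference_zero (hR : 0 < R) (hf : DifferentiableOn ℂ f (closedBall 0 R))
    (j : ℕ) : cauchyDividedDifference R f 0 j = iteratedDeriv j f 0 / j.factorial := by
  lift R to NNReal using hR.le
  have h := (hf.hasFPowerSeriesOnBall hR).factorial_smul 1 j
  rw [← iteratedDeriv_eq_iteratedFDeriv, cauchyPowerSeries_apply] at h
  rw [eq_div_iff (Nat.cast_ne_zero.2 j.factorial_ne_zero), ← h, nsmul_eq_mul, mul_comm,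
    cauchyDividedDifference]
  simp [pow_succ, mul_comm, mul_assoc, mul_left_comm]

theorem tendsto_cauchyDividedDifference (hR : 0 < R)
    (hf : DifferentiableOn ℂ f (closedBall 0 R)) {X : Type*} [TopologicalSpace X]
    [FirstCountableTopology X] {v : X → ℕ → ℂ} {U : Set X} {a : X} (hU : U ∈ nhds a)
    (hv : Continuous v) (hvU : ∀ x ∈ U, ∀ i, v x i ∈ ball 0 R) (j : ℕ) :
    Tendsto (fun x => cauchyDividedDifference R f (v x) j) (nhds a)
      (nhds (cauchyDividedDifference R f (v a) j)) := by
  refine Tendsto.const_mul _ (tendsto_circleIntegral_of_continuousOn_prod hR.le hU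
    (F := fun x z => (∏ i ∈ Finset.range (j + 1), (z - v x i))⁻¹ * f z) ?_)
  refine .mul (.inv₀ ?_ ?_) ?_
  · fun_prop
  · rintro ⟨x, z⟩ ⟨hx, hz⟩
    refine Finset.prod_ne_zero_iff.2 fun i _ => sub_ne_zero.2 fun (h : z = v x i) => ?_
    exact (mem_ball.1 (hvU x hx i)).ne (h ▸ mem_sphere.1 hz)
  · exact (hf.continuousOn.mono sphere_subset_closedBall).comp continuousOn_snd fun p hp => hp.2

end

/-- The determinant of the Newton basis evaluated at its nodes is the Vandermonde product. -/
theorem det_prod_range_sub {k : ℕ} (v : ℕ → ℂ) :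
    Matrix.det (Matrix.of fun m j : Fin k => ∏ i ∈ Finset.range j, (v m - v i)) =
      ∏ p ∈ Finset.univ.filter (fun p : Fin k × Fin k => p.1 < p.2), (v p.2 - v p.1) := by
  have h := Matrix.det_eval_matrixOfPolynomials_eq_det_vandermonde (fun m : Fin k => v m)
    (fun j => Lagrange.nodal (Finset.range j) v) (fun j => by simp)
    (fun j => Lagrange.nodal_monic)
  simp only [Lagrange.eval_nodal] at h
  rw [← h, Matrix.det_vandermonde, Finset.prod_filter, ← Finset.univ_product_univ,
    Finset.prod_product]
  refine Finset.prod_congr rfl fun i _ => ?_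
  rw [← Finset.prod_filter]
  exact Finset.prod_congr (by ext; simp) fun _ _ => rfl

/-- as the tuple `(w_1, …, w_k)` of pairwise distinct complex numbers tends
to `(0, …, 0)`, the ratio `det(g_n(w_m)) / ∏_{m<n}(w_n − w_m)` converges to
`det(g_n^{(m−1)}(0)) / ∏_{j=0}^{k−1} j!` for analytic functions `g_n`. -/
theorem det_ratio_tendsto_confluent (k : ℕ) (hk : 1 ≤ k) (g : Fin k → ℂ → ℂ)
    (hg : ∀ n, AnalyticAt ℂ (g n) 0) :
    Tendsto
      (fun w : Fin k → ℂ =>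
        Matrix.det (Matrix.of fun m n : Fin k => g n (w m)) /
          ∏ p ∈ Finset.univ.filter (fun p : Fin k × Fin k => p.1 < p.2),
            (w p.2 - w p.1))
      (nhdsWithin (0 : Fin k → ℂ) {w : Fin k → ℂ | Function.Injective w})
      (nhds
        (Matrix.det (Matrix.of fun m n : Fin k => iteratedDeriv (m : ℕ) (g n) 0) /
          ∏ j ∈ Finset.range k, (Nat.factorial j : ℂ))) := by
  obtain ⟨R, hR, hgR⟩ : ∃ R > 0, ∀ n, DifferentiableOn ℂ (g n) (Metric.closedBall 0 R) := by
    have h : ∀ᶠ z in nhds (0 : ℂ), ∀ n, DifferentiableAt ℂ (g n) z :=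
      eventually_all.2 fun n => (hg n).eventually_analyticAt.mono fun z hz => hz.differentiableAt
    obtain ⟨R, hR, hsub⟩ := Metric.nhds_basis_closedBall.mem_iff.1 h
    exact ⟨R, hR, fun n z hz => (hsub hz n).differentiableWithinAt⟩
  let v (w : Fin k → ℂ) (i : ℕ) : ℂ := if h : i < k then w ⟨i, h⟩ else 0
  have hv_fin (w : Fin k → ℂ) (i : Fin k) : v w i = w i := by simp [v]
  have hv_zero : v 0 = 0 := by ext i; simp [v]
  have hv_cont : Continuous v := by
    refine continuous_pi fun i => ?_
    by_cases h : i < k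
    · simpa only [v, dif_pos h] using continuous_apply _
    · simpa only [v, dif_neg h] using continuous_const
  have hv_ball (w) (hw : w ∈ Metric.ball (0 : Fin k → ℂ) R) (i : ℕ) :
      v w i ∈ Metric.ball (0 : ℂ) R := by
    by_cases h : i < k
    · simpa [v, h] using (norm_le_pi_norm w ⟨i, h⟩).trans_lt (mem_ball_zero_iff.1 hw)
    · simpa [v, h] using hR
  have hlim : Tendsto (fun w => Matrix.det (Matrix.of fun m n : Fin k =>
      cauchyDividedDifference R (g n) (v w) m)) (nhds 0)
      (nhds (Matrix.det (Matrix.of fun m n : Fin k =>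
        cauchyDividedDifference R (g n) 0 m))) := by
    refine (continuous_id.matrix_det.tendsto _).comp
      (tendsto_pi_nhds.2 fun m => tendsto_pi_nhds.2 fun n => ?_)
    simpa only [hv_zero, Matrix.of_apply] using tendsto_cauchyDividedDifference hR (hgR n)
      (Metric.ball_mem_nhds 0 hR) hv_cont hv_ball m
  have hval : Matrix.det (Matrix.of fun m n : Fin k => cauchyDividedDifference R (g n) 0 m) =
      Matrix.det (Matrix.of fun m n : Fin k => iteratedDeriv (m : ℕ) (g n) 0) /
        ∏ j ∈ Finset.range k, (Nat.factorial j : ℂ) := by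
    simp only [cauchyDividedDifference_zero hR (hgR _), div_eq_inv_mul]
    rw [← Finset.prod_inv_distrib, ← Fin.prod_univ_eq_prod_range]
    exact Matrix.det_mul_column (fun m : Fin k => ((m : ℕ).factorial : ℂ)⁻¹) _
  rw [← hval]
  refine (hlim.mono_left nhdsWithin_le_nhds).congr' ?_
  filter_upwards [self_mem_nhdsWithin,
    mem_nhdsWithin_of_mem_nhds (Metric.ball_mem_nhds 0 hR)] with w hw hwR
  have hprod : ∏ p ∈ Finset.univ.filter (fun p : Fin k × Fin k => p.1 < p.2),
      (w p.2 - w p.1) ≠ 0 :=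
    Finset.prod_ne_zero_iff.2 fun p hp =>
      sub_ne_zero.2 (hw.ne (ne_of_gt (Finset.mem_filter.1 hp).2))
  have hvand := det_prod_range_sub (k := k) (v w)
  simp only [hv_fin] at hvand
  rw [eq_div_iff hprod, ← hvand, mul_comm, ← Matrix.det_mul]
  congr 1
  ext m n
  have h := eq_sum_cauchyDividedDifference (hgR n) (hv_ball w hwR) m.isLt
  rw [hv_fin] at h
  rw [Matrix.of_apply, h, Matrix.mul_apply]
  simp only [Matrix.of_apply]
  exact Fin.sum_univ_eq_sum_range (fun j => (∏ i ∈ Finset.range j, (w m - v w i)) *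
    cauchyDividedDifference R (g n) (v w) j) k
end

section
/- Let u: ℝ → ℝ be twice differentiable and satisfy the Painlevé II equation u″(x) = 2u(x)³ + x·u(x) for all x. Let f, g: ℝ × ℂ → ℂ have continuous first partial derivatives and satisfy, for all (x,w): ∂_x f = u g, ∂_x g = u f − w g, ∂_w f = u² f − (w u + u′) g, and ∂_w g = (−w u + u′) f + (w² − x − u²) g. Then at every point (x,w) with w·u(x) + u′(x) ≠ 0, the second w-derivative ∂_w² f exists and −∂_w² f + ( u/(w u + u′) + w² − x )·∂_w f + ( −u³/(w u + u′) + u⁴ + x u² − (u′)² )·f = 0, where u, u′ are evaluated at x. -/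
/-- let `u` solve Painlevé II, `u″ = 2u³ + xu`, and let `f, g : ℝ × ℂ → ℂ`
(curried) have continuous first partial derivatives satisfying the Painlevé II Lax pair:
`∂_x f = u g`, `∂_x g = u f − w g`, `∂_w f = u² f − (wu + u′) g`,
`∂_w g = (−wu + u′) f + (w² − x − u²) g`. Then wherever `wu(x) + u′(x) ≠ 0` the second
`w`-derivative of `f` exists and
`−∂_w² f + (u/(wu+u′) + w² − x)·∂_w f + (−u³/(wu+u′) + u⁴ + xu² − (u′)²)·f = 0`. -/
theorem lax_pair_second_order_in_w (u : ℝ → ℝ)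
    (hu : Differentiable ℝ u) (hu' : Differentiable ℝ (deriv u))
    (hPII : ∀ x, deriv (deriv u) x = 2 * u x ^ 3 + x * u x)
    (f g : ℝ → ℂ → ℂ)
    (hfc : Continuous fun p : ℝ × ℂ => f p.1 p.2)
    (hgc : Continuous fun p : ℝ × ℂ => g p.1 p.2)
    (hfx : ∀ (x : ℝ) (w : ℂ), HasDerivAt (fun y => f y w) ((u x : ℂ) * g x w) x)
    (hgx : ∀ (x : ℝ) (w : ℂ),
      HasDerivAt (fun y => g y w) ((u x : ℂ) * f x w - w * g x w) x)
    (hfw : ∀ (x : ℝ) (w : ℂ),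
      HasDerivAt (f x) ((u x : ℂ) ^ 2 * f x w - (w * (u x : ℂ) + ((deriv u x : ℝ) : ℂ)) * g x w) w)
    (hgw : ∀ (x : ℝ) (w : ℂ),
      HasDerivAt (g x)
        ((-(w * (u x : ℂ)) + ((deriv u x : ℝ) : ℂ)) * f x w +
          (w ^ 2 - (x : ℂ) - (u x : ℂ) ^ 2) * g x w) w)
    (x : ℝ) (w : ℂ) (hne : w * (u x : ℂ) + ((deriv u x : ℝ) : ℂ) ≠ 0) :
    DifferentiableAt ℂ (fun ω => deriv (f x) ω) w ∧
      -(deriv (fun ω => deriv (f x) ω) w) +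
          ((u x : ℂ) / (w * (u x : ℂ) + ((deriv u x : ℝ) : ℂ)) + w ^ 2 - (x : ℂ)) *
            deriv (f x) w +
          (-((u x : ℂ) ^ 3) / (w * (u x : ℂ) + ((deriv u x : ℝ) : ℂ)) + (u x : ℂ) ^ 4 +
              (x : ℂ) * (u x : ℂ) ^ 2 - ((deriv u x : ℝ) : ℂ) ^ 2) * f x w = 0 := by
  have hderiv : (fun ω => deriv (f x) ω) = fun ω =>
      (u x : ℂ) ^ 2 * f x ω - (ω * (u x : ℂ) + ((deriv u x : ℝ) : ℂ)) * g x ω :=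
    funext fun ω => (hfw x ω).deriv
  have hlin : HasDerivAt (fun ω : ℂ => ω * (u x : ℂ) + ((deriv u x : ℝ) : ℂ))
      (1 * (u x : ℂ)) w :=
    ((hasDerivAt_id' w).mul_const _).add_const _
  have hsecond : HasDerivAt (fun ω => (u x : ℂ) ^ 2 * f x ω -
      (ω * (u x : ℂ) + ((deriv u x : ℝ) : ℂ)) * g x ω) _ w :=
    ((hfw x w).const_mul _).sub (hlin.mul (hgw x w))
  rw [hderiv]
  refine ⟨hsecond.differentiableAt, ?_⟩
  rw [hsecond.deriv, (hfw x w).deriv]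
  generalize hq : w * (u x : ℂ) + ((deriv u x : ℝ) : ℂ) = q at hne ⊢
  rw [eq_sub_of_add_eq' hq]
  field_simp
  ring
end
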